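/- Let C be an (n,k)_q MDS code containing the zero word 0̄, with n = q + k - 1, k > 2, and q > 2. Then the weight spectrum of C is W(C) = {n-k+1} ∪ {n-k+3, n-k+4, …, n}; that is, every weight from n-k+1 to n is realized except the weight n-k+2 = q+1. -/

import Mathlib

/-- `C ⊆ A^n` is an `(n,k)_q` MDS code: it has `q^k` codewords and its minimum
Hamming distance equals `n - k + 1`. -/
def IsMDS {A : Type*} [DecidableEq A] {n : ℕ} (q k : ℕ) (C : Finset (Fin n → A)) : Prop :=
  C.card = q ^ k ∧
    (∀ x ∈ C, ∀ y ∈ C, x ≠ y → n - k + 1 ≤ hammingDist x y) ∧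
    (∃ x ∈ C, ∃ y ∈ C, x ≠ y ∧ hammingDist x y = n - k + 1)

/-- The Hamming weight of a word `c : Fin n → A` relative to a distinguished
zero element `z` of the alphabet: the number of coordinates different from `z`. -/
def wt {A : Type*} [DecidableEq A] {n : ℕ} (z : A) (c : Fin n → A) : ℕ :=
  (Finset.univ.filter fun i => c i ≠ z).card

/-- Two codes are equivalent if one is obtained from the other by a permutation
`σ` of the coordinate positions together with a permutation `π i` of the alphabet
applied in each position `i`. -/
def CodeEquiv {A : Type*} [DecidableEq A] {n : ℕ} (C C' : Finset (Fin n → A)) : Prop :=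
  ∃ (σ : Equiv.Perm (Fin n)) (π : Fin n → Equiv.Perm A),
    C' = C.image fun c => fun i => π i (c (σ i))

open Finset in
/-- Two codewords of an MDS code that agree on `k` positions are equal. -/
theorem IsMDS.eq_of_agree {A : Type*} [DecidableEq A] {n q k : ℕ}
    {C : Finset (Fin n → A)} (hC : IsMDS q k C) {x y : Fin n → A} (hx : x ∈ C) (hy : y ∈ C)
    (S : Finset (Fin n)) (hS : k ≤ #S) (h : ∀ i ∈ S, x i = y i) : x = y := by
  by_contra hne
  have h1 := hC.2.1 x hx y hy hne
  have h2 : hammingDist x y ≤ #Sᶜ := by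
    apply card_le_card
    intro i hi
    simp only [mem_filter, mem_univ, true_and] at hi
    exact mem_compl.2 fun hiS => hi (h i hiS)
  rw [card_compl, Fintype.card_fin] at h2
  omega

open Finset in
/-- Any `k` positions of an MDS code form an information set. -/
theorem IsMDS.exists_agree {A : Type*} [Fintype A] [DecidableEq A] {n q k : ℕ}
    {C : Finset (Fin n → A)} (hC : IsMDS q k C) (hA : Fintype.card A = q)
    (S : Finset (Fin n)) (hS : #S = k) (f : Fin n → A) : ∃ c ∈ C, ∀ i ∈ S, c i = f i := by
  have hinj : Function.Injective (fun (c : C) (i : S) => c.1 i.1) := fun x y h =>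
    Subtype.ext (hC.eq_of_agree x.2 y.2 S hS.ge fun i hi => congrFun h ⟨i, hi⟩)
  have hbij := (Fintype.bijective_iff_injective_and_card _).2
    ⟨hinj, by simp [hA, hS, hC.1]⟩
  obtain ⟨c, hc⟩ := hbij.2 fun i => f i.1
  exact ⟨c.1, c.2, fun i hi => congrFun hc ⟨i, hi⟩⟩

open Finset in
/-- In an MDS code of length `q + k - 1`, any prescription on `k - 2` positions extends to a
codeword which is constantly `z`, or nowhere `z`, on the other positions. -/
theorem IsMDS.exists_zero_or_ne_zero_off {A : Type*} [Fintype A] [DecidableEq A] {n q k : ℕ}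
    {C : Finset (Fin n → A)} (hC : IsMDS q k C) (hA : Fintype.card A = q)
    (hn : n = q + k - 1) (hk : 2 ≤ k) (hq : 0 < q) (z : A)
    (T : Finset (Fin n)) (hT : #T + 2 = k) (f : Fin n → A) :
    ∃ c ∈ C, (∀ i ∈ T, c i = f i) ∧ ((∀ i ∉ T, c i = z) ∨ ∀ i ∉ T, c i ≠ z) := by
  by_contra! hno
  have hTc : #Tᶜ = q + 1 := by rw [card_compl, Fintype.card_fin]; omega
  obtain ⟨r, hr, s, hs, hrs⟩ := one_lt_card.1 (by omega : 1 < #Tᶜ)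
  rw [mem_compl] at hr hs
  have hcard : ∀ i j, i ∉ T → j ∉ T → i ≠ j → #(insert i (insert j T)) = k := by
    intro i j hi hj hij
    rw [card_insert_of_notMem (by simp [hi, hij]), card_insert_of_notMem hj]
    exact hT
  obtain ⟨c, hcC, hc⟩ := hC.exists_agree hA _ (hcard r s hr hs hrs)
    (fun i => if i ∈ T then f i else z)
  have hcT : ∀ i ∈ T, c i = f i := fun i hi => by
    rw [hc i (by simp [hi]), if_pos hi]
  have hcr : c r = z := by rw [hc r (by simp), if_neg hr]
  have hcs : c s = z := by rw [hc s (by simp), if_neg hs]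
  obtain ⟨j, hj, hjz⟩ := (hno c hcC hcT).1
  have hrj : r ≠ j := fun h => hjz (h ▸ hcr)
  have hsj : s ≠ j := fun h => hjz (h ▸ hcs)
  choose u huC hu using fun a : A => hC.exists_agree hA _ (hcard r j hr hj hrj)
    (Function.update c r a)
  have hur : ∀ a, u a r = a := fun a => by simp [hu a r (by simp)]
  have huj : ∀ a, u a j = c j := fun a => by simp [hu a j (by simp), hrj.symm]
  have huT : ∀ a, ∀ i ∈ T, u a i = c i := fun a i hi => by
    rw [hu a i (by simp [hi]), Function.update_of_ne (ne_of_mem_of_not_mem hi hr)]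
  choose g hgT hgz using fun a => (hno (u a) (huC a) fun i hi => (huT a i hi).trans (hcT i hi)).2
  have hgj : ∀ a, g a ≠ j := fun a h => hjz (by rw [← huj a, ← h, hgz])
  have heq : ∀ x ∈ C, ∀ y ∈ C, (∀ i ∈ T, x i = y i) → x j = y j → ∀ i ∉ T, i ≠ j →
      x i = y i → x = y := by
    intro x hx y hy hxyT hxyj i hi hij hxyi
    refine hC.eq_of_agree hx hy _ (hcard i j hi hj hij).ge fun l hl => ?_
    rcases mem_insert.1 hl with rfl | hl
    · exact hxyi
    rcases mem_insert.1 hl with rfl | hl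
    · exact hxyj
    · exact hxyT l hl
  have hginj : Function.Injective g := by
    intro a b hab
    have h := heq (u a) (huC a) (u b) (huC b)
      (fun i hi => (huT a i hi).trans (huT b i hi).symm) ((huj a).trans (huj b).symm)
      (g a) (hgT a) (hgj a) (by rw [hgz a, hab, hgz b])
    rw [← hur a, h, hur b]
  have himage : univ.image g = Tᶜ.erase j := by
    apply eq_of_subset_of_card_le
    · intro i hi
      obtain ⟨a, -, rfl⟩ := mem_image.1 hi
      exact mem_erase.2 ⟨hgj a, mem_compl.2 (hgT a)⟩
    · rw [card_image_of_injective _ hginj, card_erase_of_mem (mem_compl.2 hj), hTc, card_univ, hA]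
      omega
  have hc_eq : ∀ i ∉ T, i ≠ j → c i = z → ∃ a, g a = i ∧ u a = c := by
    intro i hi hij hiz
    obtain ⟨a, -, rfl⟩ := mem_image.1 (himage ▸ mem_erase.2 ⟨hij, mem_compl.2 hi⟩)
    exact ⟨a, rfl, heq (u a) (huC a) c hcC (huT a) (huj a) _ hi hij ((hgz a).trans hiz.symm)⟩
  obtain ⟨a, har, ha⟩ := hc_eq r hr hrj hcr
  obtain ⟨b, hbs, hb⟩ := hc_eq s hs hsj hcs
  have hab : a = b := by rw [← hur a, ha, ← hb, hur b]
  exact hrs (by rw [← har, ← hbs, hab])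

open Finset in
/-- An MDS code of length `q + k - 1` containing the zero word has no word with exactly `k - 2`
zeros. -/
theorem IsMDS.exists_zero_off {A : Type*} [Fintype A] [DecidableEq A] {n q k : ℕ}
    {C : Finset (Fin n → A)} (hC : IsMDS q k C) (hA : Fintype.card A = q)
    (hn : n = q + k - 1) (hk : 2 ≤ k) (hq : 0 < q) (z : A) (h0 : (fun _ => z) ∈ C)
    (T : Finset (Fin n)) (hT : #T + 2 = k) {x : Fin n → A} (hx : x ∈ C)
    (hxT : ∀ i ∈ T, x i = z) : ∃ i ∉ T, x i = z := by
  by_contra! hno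
  have hTc : #Tᶜ = q + 1 := by rw [card_compl, Fintype.card_fin]; omega
  obtain ⟨r, hr, j, hj, hrj⟩ := one_lt_card.1 (by omega : 1 < #Tᶜ)
  rw [mem_compl] at hr hj
  have hcard : ∀ i j, i ∉ T → j ∉ T → i ≠ j → #(insert i (insert j T)) = k := by
    intro i j hi hj hij
    rw [card_insert_of_notMem (by simp [hi, hij]), card_insert_of_notMem hj]
    exact hT
  have hE : ∀ i : (Tᶜ.erase j : Finset (Fin n)), i.1 ≠ j ∧ i.1 ∉ T := fun i => by
    simpa only [mem_erase, mem_compl] using i.2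
  choose w hwC hw using fun i : (Tᶜ.erase j : Finset (Fin n)) =>
    hC.exists_agree hA _ (hcard i j (hE i).2 hj (hE i).1) (Function.update x i.1 z)
  have hwi : ∀ i, w i i = z := fun i => by simp [hw i i.1 (by simp)]
  have hwj : ∀ i, w i j = x j := fun i => by simp [hw i j (by simp), (hE i).1.symm]
  have hwT : ∀ i, ∀ l ∈ T, w i l = z := fun i l hl => by
    rw [hw i l (by simp [hl]), Function.update_of_ne (ne_of_mem_of_not_mem hl (hE i).2), hxT l hl]
  have heq : ∀ a b, a ∉ T → b ∉ T → a ≠ b → ∀ x ∈ C, ∀ y ∈ C, (∀ i ∈ T, x i = y i) →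
      x a = y a → x b = y b → x = y := by
    intro a b ha hb hab x hx y hy hxyT hxya hxyb
    refine hC.eq_of_agree hx hy _ (hcard a b ha hb hab).ge fun l hl => ?_
    rcases mem_insert.1 hl with rfl | hl
    · exact hxya
    rcases mem_insert.1 hl with rfl | hl
    · exact hxyb
    · exact hxyT l hl
  have hinj : Function.Injective fun i => w i r := by
    intro a b hab
    by_contra hne
    have h := heq r j hr hj hrj (w a) (hwC a) (w b) (hwC b)
      (fun l hl => (hwT a l hl).trans (hwT b l hl).symm) hab ((hwj a).trans (hwj b).symm)
    have h' := heq a b (hE a).2 (hE b).2 (fun h => hne (Subtype.ext h)) (w a) (hwC a) _ h0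
      (hwT a) (hwi a) (by rw [h, hwi b])
    exact hno j hj (by rw [← hwj a, h'])
  have hbij := (Fintype.bijective_iff_injective_and_card _).2 ⟨hinj, by
    rw [Fintype.card_coe, card_erase_of_mem (mem_compl.2 hj), hTc, hA]; rfl⟩
  obtain ⟨i, hi⟩ := hbij.2 (x r)
  have h := heq r j hr hj hrj (w i) (hwC i) x hx
    (fun l hl => (hwT i l hl).trans (hxT l hl).symm) hi (hwj i)
  exact hno i (hE i).2 (by rw [← h, hwi i])

open Finset in
theorem wt_add_card_zeros {A : Type*} [DecidableEq A] {n : ℕ} (z : A) (c : Fin n → A) :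
    wt z c + #{i | c i = z} = n := by
  have h := card_filter_add_card_filter_not (s := univ) (fun i => c i = z)
  rw [card_univ, Fintype.card_fin, add_comm] at h
  exact h

/-- an `(n,k)_q` MDS code containing the zero word, with
`n = q + k - 1`, `k > 2` and `q > 2`, has weight spectrum
`{n-k+1} ∪ {n-k+3, …, n}`: every weight from `n-k+1` to `n` except `n-k+2`. -/
theorem stmt_16 {A : Type*} [Fintype A] [DecidableEq A] {q n k : ℕ}
    (hA : Fintype.card A = q) (z : A)
    (C : Finset (Fin n → A)) (hC : IsMDS q k C)
    (h0 : (fun _ : Fin n => z) ∈ C)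
    (hn : n = q + k - 1) (hk : 2 < k) (hq : 2 < q) :
    {w : ℕ | ∃ c ∈ C, c ≠ (fun _ : Fin n => z) ∧ wt z c = w}
      = {n - k + 1} ∪ Set.Icc (n - k + 3) n := by
  have hle := fun c : Fin n → A => wt_add_card_zeros z c
  have hmin : ∀ c ∈ C, c ≠ (fun _ => z) → q ≤ wt z c := fun c hc hne => by
    have h : n - k + 1 ≤ wt z c := hC.2.1 c hc _ h0 hne
    omega
  ext w
  simp only [Set.mem_ofPred_eq, Set.mem_union, Set.mem_singleton_iff, Set.mem_Icc]
  constructor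
  · rintro ⟨c, hc, hne, rfl⟩
    have h1 := hmin c hc hne
    have h2 := hle c
    have h3 : wt z c ≠ q + 1 := by
      intro h
      obtain ⟨i, hi, hiz⟩ := hC.exists_zero_off hA hn hk.le (by omega) z h0
        (Finset.univ.filter fun i => c i = z) (by omega) hc (by simp)
      exact hi (by simpa using hiz)
    omega
  have : Nontrivial A := Fintype.one_lt_card_iff_nontrivial.1 (by omega)
  obtain ⟨p, hp⟩ := exists_ne z
  rintro (hw | ⟨hw, hwn⟩)
  · obtain ⟨S, -, hS⟩ := Finset.exists_subset_card_eq
      (s := (Finset.univ : Finset (Fin n))) (n := k) (by simp; omega)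
    obtain ⟨t, ht⟩ := Finset.card_pos.1 (by omega : 0 < S.card)
    obtain ⟨c, hc, hcS⟩ := hC.exists_agree hA S hS (Function.update (fun _ => z) t p)
    have hne : c ≠ fun _ => z := fun h => hp (by simpa [h] using (hcS t ht).symm)
    refine ⟨c, hc, hne, ?_⟩
    have h1 := hmin c hc hne
    have h2 := hle c
    have h3 : (S.erase t).card ≤ (Finset.univ.filter fun i => c i = z).card :=
      Finset.card_le_card fun i hi => by
        have hi := Finset.mem_erase.1 hi
        simp [hcS i hi.2, hi.1]
    rw [Finset.card_erase_of_mem ht] at h3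
    omega
  · obtain ⟨T, -, hT⟩ := Finset.exists_subset_card_eq
      (s := (Finset.univ : Finset (Fin n))) (n := k - 2) (by simp; omega)
    obtain ⟨U, hUT, hU⟩ := Finset.exists_subset_card_eq
      (s := T) (n := n - w) (by omega)
    obtain ⟨t, htT, htU⟩ := Finset.exists_mem_notMem_of_card_lt_card
      (by omega : U.card < T.card)
    obtain ⟨p', hp'⟩ : ∃ p', p' ∉ ({z, p} : Finset A) := by
      obtain ⟨p', -, hp'⟩ := Finset.exists_mem_notMem_of_card_lt_card
        (s := {z, p}) (t := (Finset.univ : Finset A))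
        (lt_of_le_of_lt Finset.card_le_two (by rwa [Finset.card_univ, hA]))
      exact ⟨p', hp'⟩
    simp only [Finset.mem_insert, Finset.mem_singleton, not_or] at hp'
    have hweight : ∀ c ∈ C, (∀ i ∈ U, c i = z) → (∀ i ∉ U, c i ≠ z) →
        ∃ c ∈ C, c ≠ (fun _ : Fin n => z) ∧ wt z c = w := by
      intro c hc hcU hcU'
      refine ⟨c, hc, fun h => hcU' t htU (by rw [h]), ?_⟩
      have h : (Finset.univ.filter fun i => c i = z) = U := by
        ext i
        by_cases hi : i ∈ U
        · simp [hi, hcU i hi]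
        · simp [hi, hcU' i hi]
      have h1 := hle c
      rw [h] at h1
      omega
    have hext : ∀ v, v ≠ z → (∃ c ∈ C, (∀ i ∉ T, c i = z) ∧ c t = v ∧
        ∀ i ∈ T, i ≠ t → c i = if i ∈ U then z else p) ∨
        ∃ c ∈ C, c ≠ (fun _ : Fin n => z) ∧ wt z c = w := by
      intro v hv
      obtain ⟨c, hc, hcT, hoff | hoff⟩ := hC.exists_zero_or_ne_zero_off hA hn hk.le (by omega) z
        T (by omega) (Function.update (fun i => if i ∈ U then z else p) t v)
      · refine Or.inl ⟨c, hc, hoff, by simp [hcT t htT], fun i hi hit => ?_⟩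
        rw [hcT i hi, Function.update_of_ne hit]
      · refine Or.inr (hweight c hc (fun i hi => ?_) fun i hi => ?_)
        · rw [hcT i (hUT hi), Function.update_of_ne (ne_of_mem_of_not_mem hi htU), if_pos hi]
        · by_cases hiT : i ∈ T
          · rw [hcT i hiT]
            by_cases hit : i = t
            · simp [hit, hv]
            · simp [hit, hi, hp]
          · exact hoff i hiT
    rcases hext p hp with ⟨c, hc, hcT, hct, hcU⟩ | h
    · rcases hext p' hp'.1 with ⟨c', hc', hcT', hct', hcU'⟩ | h
      · have h := hC.eq_of_agree hc hc' (Finset.univ.erase t)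
          (by rw [Finset.card_erase_of_mem (Finset.mem_univ t), Finset.card_univ,
                Fintype.card_fin]; omega)
          (fun i hi => by
            have hit := (Finset.mem_erase.1 hi).1
            by_cases hiT : i ∈ T
            · rw [hcU i hiT hit, hcU' i hiT hit]
            · rw [hcT i hiT, hcT' i hiT])
        exact absurd (by rw [← hct', ← h, hct]) hp'.2
      · exact h
    · exact h
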